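/- Let n ≥ 10 and let C_1, …, C_{n−1} ∈ GL_r(ℂ) be an irreducible representation of B_n of dimension r with n+1 ≤ r ≤ 2n−9. Then there exists a nonzero vector v ∈ ℂ^r such that C_i v ∈ span{v} for every i ∈ {1, …, n−3} ∪ {n−1}. -/

import Mathlib

/-- `C 0, …, C (k-1)` are invertible and satisfy the braid relations of `B_{k+1}`. -/
structure IsBraid {V : Type} [AddCommGroup V] [Module ℂ V] (k : ℕ)
    (C : ℕ → Module.End ℂ V) : Prop where
  unit : ∀ i, i < k → IsUnit (C i)
  comm : ∀ i j, i + 2 ≤ j → j < k → C i * C j = C j * C i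
  braid : ∀ i, i + 1 < k → C i * C (i + 1) * C i = C (i + 1) * C i * C (i + 1)

/-- small-dimensional representations are constant -/
def SmallTriv (k : ℕ) : Prop :=
  ∀ (V : Type) [AddCommGroup V] [Module ℂ V] [FiniteDimensional ℂ V]
    (C : ℕ → Module.End ℂ V), IsBraid k C → Module.finrank ℂ V + 2 ≤ k →
    ∀ i j, i < k → j < k → C i = C j

section
variable {V : Type} [AddCommGroup V] [Module ℂ V]

lemma braid_comm_eq {R : Type*} [Ring R] {a b : R} (ha : IsUnit a) (hb : IsUnit b)
    (h : a * b * a = b * a * b) (hc : a * b = b * a) : a = b := by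
  rw [← hc] at h
  exact (ha.mul hb).mul_left_cancel h

lemma IsBraid.all_eq_of_adj {k : ℕ} {C : ℕ → Module.End ℂ V} (h : IsBraid k C)
    {i : ℕ} (hi : i + 1 < k) (he : C i = C (i + 1)) :
    ∀ a b, a < k → b < k → C a = C b := by
  have up : ∀ t, i + t + 1 < k → C (i + t) = C (i + t + 1) := by
    intro t
    induction t with
    | zero => intro _; exact he
    | succ t ih =>
      intro ht
      have e := ih (by omega)
      have c := h.comm (i + t) (i + t + 2) (by omega) (by omega)
      rw [e] at c
      exact braid_comm_eq (h.unit _ (by omega)) (h.unit _ (by omega))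
        (h.braid (i + t + 1) (by omega)) c
  have down : ∀ t s, s + t = i → C s = C (s + 1) := by
    intro t
    induction t with
    | zero => intro s hs; obtain rfl : s = i := by omega
              exact he
    | succ t ih =>
      intro s hs
      have e := ih (s + 1) (by omega)
      have c := h.comm s (s + 2) (by omega) (by omega)
      rw [show s + 2 = s + 1 + 1 from rfl, ← e] at c
      exact braid_comm_eq (h.unit _ (by omega)) (h.unit _ (by omega))
        (h.braid s (by omega)) c
  have adj : ∀ s, s + 1 < k → C s = C (s + 1) := by
    intro s hs
    rcases le_total s i with hsi | hsi
    · exact down (i - s) s (by omega)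
    · have := up (s - i) (by omega)
      rwa [show i + (s - i) = s by omega] at this
  have z : ∀ a, a < k → C a = C 0 := by
    intro a
    induction a with
    | zero => intro _; rfl
    | succ a ih => intro ha; rw [← adj a ha]; exact ih (by omega)
  intro a b ha hb
  rw [z a ha, z b hb]

/-- If `C i` and `C j` differ by an affine rescaling, the representation is constant. -/
lemma IsBraid.all_eq_of_central {k : ℕ} {C : ℕ → Module.End ℂ V} (h : IsBraid k C)
    (hk : 4 ≤ k) {i j : ℕ} (hij : i + 2 ≤ j) (hj : j < k)
    (h1 : ∀ l, l < k → (C l * C i = C i * C l ↔ C l * C j = C j * C l)) :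
    ∀ a b, a < k → b < k → C a = C b := by
  by_cases h3 : i + 3 ≤ j
  · have c := (h1 (j - 1) (by omega)).1 (h.comm i (j - 1) (by omega) (by omega)).symm
    have b := h.braid (j - 1) (by omega)
    have e : j - 1 + 1 = j := by omega
    rw [e] at b
    refine h.all_eq_of_adj (i := j - 1) (by omega) ?_
    rw [e]
    exact braid_comm_eq (h.unit _ (by omega)) (h.unit _ (by omega)) b c
  · obtain rfl : j = i + 2 := by omega
    by_cases h4 : i + 3 < k
    · have c := (h1 (i + 3) (by omega)).1 (h.comm i (i + 3) (by omega) (by omega)).symm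
      exact h.all_eq_of_adj (i := i + 2) (by omega)
        (braid_comm_eq (h.unit _ (by omega)) (h.unit _ (by omega)) (h.braid (i + 2) (by omega))
          c.symm)
    · obtain ⟨t, rfl⟩ : ∃ t, i = t + 1 := ⟨i - 1, by omega⟩
      have c := (h1 t (by omega)).2 (h.comm t (t + 1 + 2) (by omega) (by omega))
      exact h.all_eq_of_adj (i := t) (by omega)
        (braid_comm_eq (h.unit _ (by omega)) (h.unit _ (by omega)) (h.braid t (by omega))
          c)

lemma glue {P A B : Module.End ℂ V} (K : Submodule ℂ V) (hP : IsUnit P)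
    (hPK : ∀ x ∈ K, P x ∈ K)
    (hA : ∀ x ∈ K, A x = P x) (hB : ∀ x ∈ K, B x = P x)
    (hA' : ∀ x, A x - P x ∈ K) (hB' : ∀ x, B x - P x ∈ K)
    (hc : P * B = B * P) (h1 : P * A * P = A * P * A) (h2 : A * B * A = B * A * B) :
    P = B := by
  obtain ⟨Y, rfl⟩ : ∃ Y, A = P + Y := ⟨A - P, by abel⟩
  obtain ⟨X, rfl⟩ : ∃ X, B = P + X := ⟨B - P, by abel⟩
  have hY0 : ∀ x ∈ K, Y x = 0 := fun x hx => by simpa using hA x hx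
  have hX0 : ∀ x ∈ K, X x = 0 := fun x hx => by simpa using hB x hx
  have hYK : ∀ x, Y x ∈ K := fun x => by simpa using hA' x
  have hXK : ∀ x, X x ∈ K := fun x => by simpa using hB' x
  have e1 : Y * P * Y = 0 := by ext x; exact hY0 _ (hPK _ (hYK x))
  have e2 : X * P * X = 0 := by ext x; exact hX0 _ (hPK _ (hXK x))
  have e3 : Y * X = 0 := by ext x; exact hY0 _ (hXK x)
  have e4 : X * Y = 0 := by ext x; exact hX0 _ (hYK x)
  have hc' : P * X = X * P := by
    have : P * P + P * X = P * P + X * P := by simpa [mul_add, add_mul] using hc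
    exact add_left_cancel this
  have f1 : P * Y * P = P * P * Y + Y * P * P := by
    have : (P + Y) * P * (P + Y) - P * P * P = P * P * Y + Y * P * P + Y * P * Y := by
      noncomm_ring
    rw [← h1, e1, add_zero] at this
    rw [← this]; noncomm_ring
  have f2 : P * P * Y + P * X * P + Y * P * P = P * P * X + P * Y * P + X * P * P := by
    have t1 : (P + Y) * (P + X) * (P + Y) = P * P * P + (P * P * Y + P * X * P + Y * P * P)
      + (P * (X * Y) + Y * P * Y + (Y * X) * P + (Y * X) * Y) := by noncomm_ring
    have t2 : (P + X) * (P + Y) * (P + X) = P * P * P + (P * P * X + P * Y * P + X * P * P)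
      + (P * (Y * X) + X * P * X + (X * Y) * P + (X * Y) * X) := by noncomm_ring
    rw [t1, t2] at h2
    simpa [e1, e2, e3, e4] using h2
  have f3 : X * (P * P) = 0 := by
    have t : P * X * P = P * P * X + X * P * P := by
      rw [f1] at f2
      have := congrArg (fun z => z - P * P * Y - Y * P * P) f2
      rw [show P * P * Y + P * X * P + Y * P * P - P * P * Y - Y * P * P = P * X * P by abel,
       show P * P * X + (P * P * Y + Y * P * P) + X * P * P - P * P * Y - Y * P * P
        = P * P * X + X * P * P by abel] at this
      exact this
    have t3 : P * P * X = X * P * P := by rw [mul_assoc, hc', ← mul_assoc, hc']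
    rw [t3, hc'] at t
    rw [← mul_assoc]
    simpa using t
  have : X = 0 := by
    have t : X * (P * P) = 0 * (P * P) := by rw [f3, zero_mul]
    exact (hP.mul hP).mul_right_cancel t
  rw [this, add_zero]

lemma IsBraid.pull {U : Type} [AddCommGroup U] [Module ℂ U] [FiniteDimensional ℂ U] {k : ℕ}
    {C : ℕ → Module.End ℂ V} {D : ℕ → Module.End ℂ U} (h : IsBraid k C)
    (f : U →ₗ[ℂ] V) (hf : Function.Injective f) (hD : ∀ i, i < k → ∀ x, f (D i x) = C i (f x)) :
    IsBraid k D := by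
  refine ⟨fun i hi => ?_, fun i j hij hj => ?_, fun i hi => ?_⟩
  · rw [LinearMap.isUnit_iff_ker_eq_bot, LinearMap.ker_eq_bot]
    intro x y hxy
    have := congrArg f hxy
    rw [hD i hi, hD i hi] at this
    exact hf (((Module.End.isUnit_iff _).1 (h.unit i hi)).1 this)
  · ext x
    apply hf
    simp only [Module.End.mul_apply]
    rw [hD i (by omega), hD j hj, hD j hj, hD i (by omega)]
    exact LinearMap.congr_fun (h.comm i j hij hj) (f x)
  · ext x
    apply hf
    simp only [Module.End.mul_apply]
    rw [hD i (by omega), hD (i+1) hi, hD i (by omega), hD (i+1) hi, hD i (by omega),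
      hD (i+1) hi]
    exact LinearMap.congr_fun (h.braid i hi) (f x)

lemma IsBraid.push {U : Type} [AddCommGroup U] [Module ℂ U] [FiniteDimensional ℂ U] {k : ℕ}
    {C : ℕ → Module.End ℂ V} {D : ℕ → Module.End ℂ U} (h : IsBraid k C)
    (f : V →ₗ[ℂ] U) (hf : Function.Surjective f) (hD : ∀ i, i < k → ∀ x, D i (f x) = f (C i x)) :
    IsBraid k D := by
  refine ⟨fun i hi => ?_, fun i j hij hj => ?_, fun i hi => ?_⟩
  · rw [LinearMap.isUnit_iff_range_eq_top, LinearMap.range_eq_top]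
    intro y
    obtain ⟨x, rfl⟩ := hf y
    obtain ⟨z, rfl⟩ := ((Module.End.isUnit_iff _).1 (h.unit i hi)).2 x
    exact ⟨f z, hD i hi z⟩
  · ext y
    obtain ⟨x, rfl⟩ := hf y
    simp only [Module.End.mul_apply]
    rw [hD i (by omega), hD j hj, hD j hj, hD i (by omega)]
    exact congrArg f (LinearMap.congr_fun (h.comm i j hij hj) x)
  · ext y
    obtain ⟨x, rfl⟩ := hf y
    simp only [Module.End.mul_apply]
    rw [hD i (by omega), hD (i+1) hi, hD i (by omega), hD (i+1) hi, hD i (by omega),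
      hD (i+1) hi]
    exact congrArg f (LinearMap.congr_fun (h.braid i hi) x)

lemma IsBraid.mono {k l : ℕ} {C : ℕ → Module.End ℂ V} (h : IsBraid k C) (hl : l ≤ k) :
    IsBraid l C :=
  ⟨fun i hi => h.unit i (by omega), fun i j hij hj => h.comm i j hij (by omega),
    fun i hi => h.braid i (by omega)⟩

open Classical in
/-- restriction to a submodule (zero if not invariant) -/
noncomputable def resEnd (K : Submodule ℂ V) (f : Module.End ℂ V) : Module.End ℂ K :=
  if h : ∀ x ∈ K, f x ∈ K then f.restrict h else 0

lemma resEnd_coe (K : Submodule ℂ V) (f : Module.End ℂ V) (h : ∀ x ∈ K, f x ∈ K) (x : K) :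
    (resEnd K f x : V) = f x := by
  simp [resEnd, dif_pos h]

open Classical in
/-- induced map on a quotient (zero if not invariant) -/
noncomputable def quoEnd (K : Submodule ℂ V) (f : Module.End ℂ V) : Module.End ℂ (V ⧸ K) :=
  if h : ∀ x ∈ K, f x ∈ K then K.mapQ K f h else 0

lemma quoEnd_mk (K : Submodule ℂ V) (f : Module.End ℂ V) (h : ∀ x ∈ K, f x ∈ K) (x : V) :
    quoEnd K f (K.mkQ x) = K.mkQ (f x) := by
  simp [quoEnd, dif_pos h]

variable [FiniteDimensional ℂ V]

lemma IsBraid.res {k : ℕ} {C : ℕ → Module.End ℂ V} (h : IsBraid k C)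
    (K : Submodule ℂ V) (hK : ∀ i, i < k → ∀ x ∈ K, C i x ∈ K) :
    IsBraid k (fun i => resEnd K (C i)) :=
  h.pull K.subtype K.injective_subtype fun i hi x => resEnd_coe K (C i) (hK i hi) x

lemma SmallTriv.on_sub {k : ℕ} (T : SmallTriv k) {C : ℕ → Module.End ℂ V} (h : IsBraid k C)
    (K : Submodule ℂ V) (hK : ∀ i, i < k → ∀ x ∈ K, C i x ∈ K)
    (hd : Module.finrank ℂ K + 2 ≤ k) (i j : ℕ) (hi : i < k) (hj : j < k) :
    ∀ x ∈ K, C i x = C j x := by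
  intro x hx
  have e := T K _ (h.res K hK) hd i j hi hj
  have e2 := congrArg (fun f => ((f ⟨x, hx⟩ : K) : V)) e
  simpa only [resEnd_coe K _ (hK i hi), resEnd_coe K _ (hK j hj)] using e2

lemma SmallTriv.on_quo {k : ℕ} (T : SmallTriv k) {C : ℕ → Module.End ℂ V} (h : IsBraid k C)
    (K : Submodule ℂ V) (hK : ∀ i, i < k → ∀ x ∈ K, C i x ∈ K)
    (hd : Module.finrank ℂ V + 2 ≤ k + Module.finrank ℂ K) (i j : ℕ) (hi : i < k) (hj : j < k) :
    ∀ x, C i x - C j x ∈ K := by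
  intro x
  have hq := K.finrank_quotient_add_finrank
  have e := T (V ⧸ K) (fun i => quoEnd K (C i)) (h.push K.mkQ K.mkQ_surjective
    fun i hi x => quoEnd_mk K (C i) (hK i hi) x) (by omega) i j hi hj
  have e2 := LinearMap.congr_fun e (K.mkQ x)
  simp only [quoEnd_mk K _ (hK i hi), quoEnd_mk K _ (hK j hj)] at e2
  exact (Submodule.Quotient.eq K).1 e2

lemma comm2 {C S T : Module.End ℂ V} (hd : Module.finrank ℂ V = 2)
    (hC : ∀ a : ℂ, C ≠ a • LinearMap.id) (hS : S * C = C * S) (hT : T * C = C * T) :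
    S * T = T * S := by
  have : ∃ v, LinearIndependent ℂ ![v, C v] := by
    by_contra hcon
    push Not at hcon
    obtain ⟨a, ha⟩ := C.exists_eq_smul_id_of_forall_notLinearIndependent hcon
    exact hC a ha
  obtain ⟨v, hv⟩ := this
  have hsp := hv.span_eq_top_of_card_eq_finrank (by simp [hd])
  have hmem : ∀ x : V, ∃ a b : ℂ, a • v + b • C v = x := by
    intro x
    have : x ∈ Submodule.span ℂ (Set.range ![v, C v]) := hsp ▸ Submodule.mem_top
    rw [Matrix.range_cons, Matrix.range_cons, Matrix.range_empty, Set.union_empty,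
      Set.singleton_union] at this
    exact Submodule.mem_span_pair.1 this
  have hS' : ∀ x, S (C x) = C (S x) := fun x => LinearMap.congr_fun hS x
  have hT' : ∀ x, T (C x) = C (T x) := fun x => LinearMap.congr_fun hT x
  obtain ⟨a, b, hab⟩ := hmem (S v)
  obtain ⟨c, e, hce⟩ := hmem (T v)
  have key : S (T v) = T (S v) := by
    rw [← hab, ← hce]
    simp only [map_add, map_smul, hS', hT']
    rw [← hab, ← hce]
    simp only [map_add, map_smul, smul_add, smul_smul]
    rw [mul_comm c a, mul_comm c b, mul_comm e a, mul_comm e b]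
    abel
  ext x
  obtain ⟨p, q, rfl⟩ := hmem x
  simp only [Module.End.mul_apply, map_add, map_smul, hS', hT', key]

/-- The pseudo-reflection case. -/
lemma rank_one_case {k : ℕ} {C : ℕ → Module.End ℂ V} (h : IsBraid k C) (hk : 4 ≤ k)
    (hd : Module.finrank ℂ V + 2 ≤ k) (lam : ℂ) (hlam : lam ≠ 0) (w0 : V) (f0 : V →ₗ[ℂ] ℂ)
    (hw0 : w0 ≠ 0) (hf0 : f0 ≠ 0) (h0 : ∀ x, C (k - 1) x = lam • x + f0 x • w0) :
    ∀ a b, a < k → b < k → C a = C b := by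
  have ex : ∀ t i, i + t + 1 = k → ∃ (w : V) (f : V →ₗ[ℂ] ℂ), w ≠ 0 ∧ f ≠ 0 ∧
      ∀ x, C i x = lam • x + f x • w := by
    intro t
    induction t with
    | zero => intro i hi; obtain rfl : i = k - 1 := by omega
              exact ⟨w0, f0, hw0, hf0, h0⟩
    | succ t ih =>
      intro i hi
      obtain ⟨w, f, hw, hf, hx⟩ := ih (i + 1) (by omega)
      have hg : IsUnit (C i * C (i + 1)) := (h.unit i (by omega)).mul (h.unit _ (by omega))
      have hgb := (Module.End.isUnit_iff _).1 hg
      obtain ⟨w', hw'⟩ := hgb.2 w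
      refine ⟨w', f ∘ₗ (C i * C (i + 1)), ?_, ?_, ?_⟩
      · rintro rfl; exact hw (by rw [← hw', map_zero])
      · intro hz
        apply hf
        ext x
        obtain ⟨y, rfl⟩ := hgb.2 x
        exact LinearMap.congr_fun hz y
      · intro x
        apply hgb.1
        have b := LinearMap.congr_fun (h.braid i (by omega)) x
        have e : (C i * C (i + 1)) (C i x) = C (i + 1) ((C i * C (i + 1)) x) := b
        rw [e, hx, map_add, map_smul, map_smul, hw']
        rfl
  have ex' : ∀ i, ∃ (w : V) (f : V →ₗ[ℂ] ℂ), i < k → (w ≠ 0 ∧ f ≠ 0 ∧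
      ∀ x, C i x = lam • x + f x • w) := by
    intro i
    by_cases hi : i < k
    · obtain ⟨w, f, hh⟩ := ex (k - 1 - i) i (by omega)
      exact ⟨w, f, fun _ => hh⟩
    · exact ⟨0, 0, fun h => absurd h hi⟩
  choose w f hwf using ex'
  by_contra hne
  -- far indices
  have far : ∀ i j, i + 2 ≤ j → j < k → f j (w i) = 0 := by
    intro i j hij hj
    by_contra hnz
    apply hne
    obtain ⟨hwi, hfi, hCi⟩ := hwf i (by omega)
    obtain ⟨hwj, hfj, hCj⟩ := hwf j hj
    have hcm : ∀ x, (f j x * f i (w j)) • w i = (f i x * f j (w i)) • w j := by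
      intro x
      have := LinearMap.congr_fun (h.comm i j hij hj) x
      simp only [Module.End.mul_apply, hCi, hCj, map_add, map_smul, smul_add, add_smul,
        smul_smul, smul_eq_mul] at this
      have t := sub_eq_zero.2 this
      rw [← sub_eq_zero, ← t]
      abel
    obtain ⟨x, hx⟩ : ∃ x, f i x ≠ 0 := by
      by_contra hc; push Not at hc; exact hfi (LinearMap.ext hc)
    obtain ⟨c, hc⟩ : ∃ c : ℂ, w j = c • w i := by
      refine ⟨(f i x * f j (w i))⁻¹ * (f j x * f i (w j)), ?_⟩
      rw [mul_smul, hcm x, smul_smul, inv_mul_cancel₀ (mul_ne_zero hx hnz), one_smul]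
    have hc0 : c ≠ 0 := by rintro rfl; exact hwj (by simpa using hc)
    have hfij : ∀ y, f j y * f i (w j) = f i y * f j (w i) * c := by
      intro y
      have := hcm y
      rw [hc, smul_smul] at this
      rw [← hc] at this
      exact smul_left_injective ℂ hwi this
    have hnz2 : f i (w j) ≠ 0 := by
      intro hz
      have := hfij x
      rw [hz, mul_zero] at this
      exact mul_ne_zero (mul_ne_zero hx hnz) hc0 this.symm
    obtain ⟨s, hs0, hs⟩ : ∃ s : ℂ, s ≠ 0 ∧ ∀ y, f j y • w j = s • (f i y • w i) := by
      refine ⟨f j (w i) * c * (f i (w j))⁻¹ * c, by simp [hnz, hc0, hnz2], fun y => ?_⟩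
      have : f j y = f i y * f j (w i) * c * (f i (w j))⁻¹ := by
        rw [← hfij y, mul_assoc, mul_inv_cancel₀ hnz2, mul_one]
      have hw : f j y • w j = (f j y * c) • w i := by
        conv_lhs => rw [hc, smul_smul]
      rw [hw, this, smul_smul]
      congr 1
      ring
    refine h.all_eq_of_central hk hij hj fun l hl => ?_
    have hji : C j = (lam - s * lam) • 1 + s • C i := by
      ext y
      simp only [LinearMap.add_apply, LinearMap.smul_apply, LinearMap.sub_apply, Module.End.one_apply, hCi, hCj,
        hs, smul_add, sub_smul, mul_smul]
      abel
    rw [hji]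
    simp only [mul_add, add_mul, mul_smul_comm, smul_mul_assoc, mul_one, one_mul]
    rw [add_right_inj, (smul_right_injective _ hs0).eq_iff]
  -- adjacent indices
  have near : ∀ i, i + 1 < k → f (i + 1) (w i) ≠ 0 := by
    intro i hi hz
    apply hne
    apply h.all_eq_of_adj hi
    obtain ⟨-, -, hCi⟩ := hwf i (by omega)
    obtain ⟨-, -, hCj⟩ := hwf (i + 1) hi
    obtain ⟨A, hA⟩ : ∃ A, A = C i - lam • 1 := ⟨_, rfl⟩
    obtain ⟨B, hB⟩ : ∃ B, B = C (i + 1) - lam • 1 := ⟨_, rfl⟩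
    have hA' : C i = lam • 1 + A := by rw [hA]; abel
    have hB' : C (i + 1) = lam • 1 + B := by rw [hB]; abel
    have hAx : ∀ x, A x = f i x • w i := by intro x; simp [hA, hCi]
    have hBx : ∀ x, B x = f (i + 1) x • w (i + 1) := by intro x; simp [hB, hCj]
    have hBA : B * A = 0 := by
      ext x; simp [hAx, hBx, hz]
    have e : A * C i = B * C (i + 1) := by
      have hb := h.braid i hi
      have t1 : C i * C (i + 1) * C i = lam • (lam • (lam • 1)) + lam • (lam • (A + B)) +
          lam • (A * C i) + lam • (A * B + B * A) + A * (B * A) := by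
        rw [hA', hB']
        simp only [mul_add, add_mul, mul_smul_comm, smul_mul_assoc, mul_one, one_mul, smul_add,
          mul_assoc]
        abel
      have t2 : C (i + 1) * C i * C (i + 1) = lam • (lam • (lam • 1)) + lam • (lam • (A + B)) +
          lam • (B * C (i + 1)) + lam • (A * B + B * A) + (B * A) * B := by
        rw [hA', hB']
        simp only [mul_add, add_mul, mul_smul_comm, smul_mul_assoc, mul_one, one_mul, smul_add,
          mul_assoc]
        abel
      rw [t1, t2, hBA] at hb
      simp only [mul_zero, zero_mul, add_zero] at hb
      exact smul_right_injective _ hlam (add_left_cancel (add_right_cancel hb))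
    have hBB : B * B = 0 := by
      have : B * B * C (i + 1) = 0 * C (i + 1) := by
        rw [mul_assoc, ← e, ← mul_assoc, hBA, zero_mul, zero_mul]
      exact (h.unit _ hi).mul_right_cancel this
    have e' : A * C i = lam • B := by
      rw [e, hB', mul_add, hBB]; simp
    have hCA : C i * A = A * C i := by rw [hA']; simp [mul_add, add_mul]
    have hAA : A * A = 0 := by
      have : C i * (A * A) = C i * 0 := by
        rw [← mul_assoc, hCA, e', smul_mul_assoc, hBA]; simp
      exact (h.unit _ (by omega)).mul_left_cancel this
    have : A = B := by
      rw [hA', mul_add, hAA] at e'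
      simp only [mul_smul_comm, mul_one, add_zero] at e'
      exact smul_right_injective _ hlam e'
    rw [hA', hB', this]
  have li : ∀ t, t + 1 ≤ k → LinearIndependent ℂ (fun i : Fin t => w i) := by
    intro t
    induction t with
    | zero => intro _; exact linearIndependent_empty_type
    | succ t ih =>
      intro ht
      rw [linearIndependent_finSucc']
      refine ⟨ih (by omega), ?_⟩
      intro hmem
      have hle : Submodule.span ℂ (Set.range (Fin.init fun i : Fin (t + 1) => w i)) ≤
          LinearMap.ker (f (t + 1)) := by
        rw [Submodule.span_le]
        rintro _ ⟨i, rfl⟩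
        exact far i (t + 1) (by have := i.2; omega) (by omega)
      exact near t (by omega) (hle hmem)
  have := (li (k - 1) (by omega)).fintype_card_le_finrank
  simp at this
  omega

lemma finish_glue {k : ℕ} {C : ℕ → Module.End ℂ V} (h : IsBraid k C) (hk : 5 ≤ k)
    (K : Submodule ℂ V) (hK : ∀ i, i < k - 2 → ∀ x ∈ K, C i x ∈ K)
    (h1 : ∀ i, i < k - 2 → ∀ x ∈ K, C i x = C 0 x)
    (h2 : ∀ i, i < k - 2 → ∀ x, C i x - C 0 x ∈ K) :
    ∀ a b, a < k → b < k → C a = C b := by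
  have e : C 0 = C 2 := glue K (h.unit 0 (by omega)) (hK 0 (by omega)) (h1 1 (by omega))
    (h1 2 (by omega)) (h2 1 (by omega)) (h2 2 (by omega)) (h.comm 0 2 (by omega) (by omega))
    (h.braid 0 (by omega)) (h.braid 1 (by omega))
  refine h.all_eq_of_central (by omega) (i := 0) (j := 2) (by omega) (by omega) fun l _ => ?_
  rw [e]

lemma finish_small {k : ℕ} (T : SmallTriv (k - 2)) {C : ℕ → Module.End ℂ V} (h : IsBraid k C)
    (hk : 5 ≤ k) (K : Submodule ℂ V) (hK : ∀ i, i < k - 2 → ∀ x ∈ K, C i x ∈ K)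
    (hd1 : Module.finrank ℂ K + 4 ≤ k)
    (hd2 : Module.finrank ℂ V + 4 ≤ k + Module.finrank ℂ K) :
    ∀ a b, a < k → b < k → C a = C b := by
  have h' : IsBraid (k - 2) C := h.mono (by omega)
  refine finish_glue h hk K hK (fun i hi => ?_) (fun i hi => ?_)
  · exact T.on_sub h' K hK (by omega) i 0 hi (by omega)
  · exact T.on_quo h' K hK (by omega) i 0 hi (by omega)

lemma rank_le_one_case {k : ℕ} {C : ℕ → Module.End ℂ V} (h : IsBraid k C) (hk : 4 ≤ k)
    (hd : Module.finrank ℂ V + 2 ≤ k) (hd2 : 2 ≤ Module.finrank ℂ V) (mu : ℂ)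
    (hr : Module.finrank ℂ (LinearMap.range (C (k - 1) - mu • (1 : Module.End ℂ V))) ≤ 1) :
    ∀ a b, a < k → b < k → C a = C b := by
  obtain ⟨w, hw⟩ := ((Submodule.finrank_le_one_iff_isPrincipal _).1 hr).principal
  have hmem : ∀ x, ∃ c : ℂ, c • w = C (k - 1) x - mu • x := by
    intro x
    have : (C (k - 1) - mu • (1 : Module.End ℂ V)) x ∈ Submodule.span ℂ {w} := by
      rw [← hw]; exact LinearMap.mem_range_self _ x
    obtain ⟨c, hc⟩ := Submodule.mem_span_singleton.1 this
    exact ⟨c, by simpa using hc⟩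
  by_cases hz : C (k - 1) - mu • (1 : Module.End ℂ V) = 0
  · have e : C (k - 1) = mu • 1 := sub_eq_zero.1 hz
    have e1 : k - 2 + 1 = k - 1 := by omega
    refine h.all_eq_of_adj (i := k - 2) (by omega) ?_
    refine braid_comm_eq (h.unit _ (by omega)) (h.unit _ (by omega)) (h.braid _ (by omega)) ?_
    rw [e1, e]; simp
  have hw0 : w ≠ 0 := by
    rintro rfl
    apply hz
    ext x
    obtain ⟨c, hc⟩ := hmem x
    simpa using hc.symm
  obtain ⟨g, hg⟩ : ∃ g : V →ₗ[ℂ] ℂ, g w = 1 := by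
    have : ¬ ∀ g : Module.Dual ℂ V, g w = 0 := fun hh =>
      hw0 ((Module.forall_dual_apply_eq_zero_iff ℂ w).1 hh)
    push Not at this
    obtain ⟨g, hg⟩ := this
    exact ⟨(g w)⁻¹ • g, by simp [hg]⟩
  have hf : ∀ x, C (k - 1) x = mu • x +
      (g ∘ₗ (C (k - 1) - mu • (1 : Module.End ℂ V))) x • w := by
    intro x
    obtain ⟨c, hc⟩ := hmem x
    have : (g ∘ₗ (C (k - 1) - mu • (1 : Module.End ℂ V))) x = c := by
      have : (C (k - 1) - mu • (1 : Module.End ℂ V)) x = c • w := by simp [hc]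
      rw [LinearMap.comp_apply, this, map_smul, hg]; simp
    rw [this, hc]; abel
  refine rank_one_case h hk hd mu ?_ w _ hw0 ?_ hf
  · rintro rfl
    have hu := (LinearMap.isUnit_iff_range_eq_top _).1 (h.unit (k - 1) (by omega))
    rw [zero_smul, sub_zero, hu, finrank_top] at hr
    omega
  · intro h0
    apply hz
    ext x
    have := hf x
    rw [h0] at this
    simp [this]

theorem smallTriv (k : ℕ) : SmallTriv k := by
  induction k using Nat.strong_induction_on with
  | _ k IH =>
  intro V _ _ _ C h hd
  by_cases hd1 : Module.finrank ℂ V ≤ 1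
  · obtain ⟨v, hv⟩ := finrank_le_one_iff.1 hd1
    have hs : ∀ f : Module.End ℂ V, ∃ c : ℂ, f = c • 1 := by
      intro f
      obtain ⟨c, hc⟩ := hv (f v)
      refine ⟨c, ?_⟩
      ext x
      obtain ⟨a, rfl⟩ := hv x
      simp [← hc, smul_comm a c]
    refine h.all_eq_of_adj (i := 0) (by omega) ?_
    refine braid_comm_eq (h.unit _ (by omega)) (h.unit _ (by omega)) (h.braid _ (by omega)) ?_
    obtain ⟨c, hc⟩ := hs (C 0)
    rw [hc]; simp
  have T : SmallTriv (k - 2) := IH (k - 2) (by omega)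
  have hnt : Nontrivial V := Module.nontrivial_of_finrank_pos (R := ℂ) (by omega)
  by_cases hr : ∃ mu : ℂ,
      Module.finrank ℂ (LinearMap.range (C (k - 1) - mu • (1 : Module.End ℂ V))) ≤ 1
  · obtain ⟨mu, hr⟩ := hr
    exact rank_le_one_case h (by omega) hd (by omega) mu hr
  push Not at hr
  have hDc : ∀ i, i < k - 2 → ∀ x, C (k - 1) (C i x) = C i (C (k - 1) x) := fun i hi x =>
    (LinearMap.congr_fun (h.comm i (k - 1) (by omega) (by omega)) x).symm
  generalize hD : C (k - 1) = D at hr hDc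
  have hNc : ∀ (mu : ℂ) i, i < k - 2 → ∀ x, (D - mu • (1 : Module.End ℂ V)) (C i x) =
      C i ((D - mu • (1 : Module.End ℂ V)) x) := by
    intro mu i hi x
    simp [hDc i hi]
  have hrk : ∀ mu : ℂ, _ := fun mu =>
    (D - mu • (1 : Module.End ℂ V)).finrank_range_add_finrank_ker
  by_cases hker : ∃ mu : ℂ,
      2 ≤ Module.finrank ℂ (LinearMap.ker (D - mu • (1 : Module.End ℂ V)))
  · obtain ⟨mu, hm⟩ := hker
    have h1 := hrk mu
    have h2 := hr mu
    refine finish_small T h (by omega) (LinearMap.ker (D - mu • (1 : Module.End ℂ V))) ?_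
      (by omega) (by omega)
    intro i hi x hx
    rw [LinearMap.mem_ker] at hx ⊢
    rw [hNc mu i hi, hx, map_zero]
  push Not at hker
  have hpos : ∀ (mu : ℂ) (v : V), v ≠ 0 → D v = mu • v →
      1 ≤ Module.finrank ℂ (LinearMap.ker (D - mu • (1 : Module.End ℂ V))) := by
    intro mu v hv hDv
    rw [Nat.one_le_iff_ne_zero, Ne, Submodule.finrank_eq_zero]
    intro hb
    have : v ∈ LinearMap.ker (D - mu • (1 : Module.End ℂ V)) := by simp [hDv]
    rw [hb] at this
    exact hv (by simpa using this)
  obtain ⟨mu, hmu⟩ := Module.End.exists_eigenvalue D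
  obtain ⟨v, hv⟩ := hmu.exists_hasEigenvector
  have h1 := hpos mu v hv.2 hv.apply_eq_smul
  have h2 := hker mu
  have h3 := hrk mu
  have h4 := hr mu
  obtain ⟨I, hI⟩ : ∃ I, I = LinearMap.range (D - mu • (1 : Module.End ℂ V)) := ⟨_, rfl⟩
  rw [← hI] at h3 h4
  have hIinv : ∀ i, i < k - 2 → ∀ x ∈ I, C i x ∈ I := by
    intro i hi x hx
    rw [hI] at hx ⊢
    obtain ⟨y, rfl⟩ := hx
    exact ⟨C i y, hNc mu i hi y⟩
  have hID : ∀ x ∈ I, D x ∈ I := by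
    intro x hx
    rw [hI] at hx ⊢
    obtain ⟨y, rfl⟩ := hx
    exact ⟨D y, by simp⟩
  by_cases hd3 : Module.finrank ℂ V = 3
  · have h' : IsBraid (k - 2) C := h.mono (by omega)
    have hres := h'.res I hIinv
    have hcm : ∀ i, i < k - 2 → resEnd I (C i) * resEnd I D = resEnd I D * resEnd I (C i) := by
      intro i hi
      ext x
      simp only [Module.End.mul_apply]
      rw [resEnd_coe I _ (hIinv i hi), resEnd_coe I _ hID, resEnd_coe I _ hID,
        resEnd_coe I _ (hIinv i hi), hDc i hi]
    have hns : ∀ a : ℂ, resEnd I D ≠ a • LinearMap.id := by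
      intro a ha
      have hle : I ≤ LinearMap.ker (D - a • (1 : Module.End ℂ V)) := by
        intro x hx
        have := congrArg (fun f => ((f ⟨x, hx⟩ : I) : V)) ha
        simp only [resEnd_coe I _ hID] at this
        simp [this]
      have := Submodule.finrank_mono hle
      have := hker a
      omega
    have hc01 := comm2 (by omega) hns (hcm 0 (by omega)) (hcm 1 (by omega))
    have heq : resEnd I (C 0) = resEnd I (C 1) :=
      braid_comm_eq (hres.unit 0 (by omega)) (hres.unit 1 (by omega))
        (hres.braid 0 (by omega)) hc01
    have hall := hres.all_eq_of_adj (i := 0) (by omega) heq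
    refine finish_glue h (by omega) I hIinv (fun i hi x hx => ?_) (fun i hi => ?_)
    · have := congrArg (fun f => ((f ⟨x, hx⟩ : I) : V)) (hall i 0 hi (by omega))
      simpa only [resEnd_coe I _ (hIinv i hi), resEnd_coe I _ (hIinv 0 (by omega))] using this
    · exact T.on_quo h' I hIinv (by omega) i 0 hi (by omega)
  · have hntI : Nontrivial I := Module.nontrivial_of_finrank_pos (R := ℂ) (by omega)
    obtain ⟨nu, hnu⟩ := Module.End.exists_eigenvalue (resEnd I D)
    obtain ⟨u, hu⟩ := hnu.exists_hasEigenvector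
    have hDu : D (u : V) = nu • (u : V) := by
      have := congrArg (fun y : I => (y : V)) hu.apply_eq_smul
      simpa only [resEnd_coe I _ hID, Submodule.coe_smul] using this
    obtain ⟨F, hF⟩ : ∃ F, F = (D - nu • (1 : Module.End ℂ V)) ∘ₗ I.subtype := ⟨_, rfl⟩
    have hrkF := F.finrank_range_add_finrank_ker
    have hk1 : 1 ≤ Module.finrank ℂ (LinearMap.ker F) := by
      rw [Nat.one_le_iff_ne_zero, Ne, Submodule.finrank_eq_zero]
      intro hb
      have : u ∈ LinearMap.ker F := by simp [hF, hDu]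
      rw [hb] at this
      exact hu.2 (by simpa using this)
    have hk2 : Module.finrank ℂ (LinearMap.ker F) ≤
        Module.finrank ℂ (LinearMap.ker (D - nu • (1 : Module.End ℂ V))) := by
      have e : Module.finrank ℂ ((LinearMap.ker F).map I.subtype) =
          Module.finrank ℂ (LinearMap.ker F) :=
        Submodule.finrank_map_subtype_eq I _
      rw [← e]
      apply Submodule.finrank_mono
      rintro _ ⟨y, hy, rfl⟩
      rw [hF] at hy
      exact hy
    have hk3 := hker nu
    refine finish_small T h (by omega) (LinearMap.range F) ?_ (by omega) (by omega)
    rintro i hi _ ⟨y, rfl⟩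
    refine ⟨⟨C i y, hIinv i hi y y.2⟩, ?_⟩
    rw [hF]
    exact hNc nu i hi y

end

theorem stmt_7 (n r : ℕ) (hn : 10 ≤ n) (hr₁ : n + 1 ≤ r) (hr₂ : r ≤ 2 * n - 9)
    (C : ℕ → Matrix (Fin r) (Fin r) ℂ)
    (hinv : ∀ i, 1 ≤ i → i ≤ n - 1 → IsUnit (C i))
    (hcomm : ∀ i j, 1 ≤ i → i ≤ n - 1 → 1 ≤ j → j ≤ n - 1 → i + 2 ≤ j →
      C i * C j = C j * C i)
    (hbraid : ∀ i, 1 ≤ i → i ≤ n - 2 →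
      C i * C (i + 1) * C i = C (i + 1) * C i * C (i + 1))
    (hirr : ∀ p : Submodule ℂ (Fin r → ℂ),
      (∀ i, 1 ≤ i → i ≤ n - 1 → ∀ v ∈ p, (C i).mulVec v ∈ p) → p = ⊥ ∨ p = ⊤) :
    ∃ v : Fin r → ℂ, v ≠ 0 ∧ ∀ i, (1 ≤ i ∧ i ≤ n - 3) ∨ i = n - 1 →
      (C i).mulVec v ∈ Submodule.span ℂ {v} := by
  obtain ⟨E, hE⟩ : ∃ E : ℕ → Module.End ℂ (Fin r → ℂ),
      E = fun i => Matrix.toLinAlgEquiv' (C (i + 1)) := ⟨_, rfl⟩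
  have hEx : ∀ i x, E i x = (C (i + 1)).mulVec x := by
    intro i x; rw [hE]; exact Matrix.toLinAlgEquiv'_apply _ _
  have h : IsBraid (n - 1) E := by
    refine ⟨fun i hi => ?_, fun i j hij hj => ?_, fun i hi => ?_⟩
    · rw [hE]; exact (hinv (i + 1) (by omega) (by omega)).map Matrix.toLinAlgEquiv'
    · rw [hE]; simp only [← map_mul]
      rw [hcomm (i + 1) (j + 1) (by omega) (by omega) (by omega) (by omega) (by omega)]
    · rw [hE]; simp only [← map_mul]
      rw [hbraid (i + 1) (by omega) (by omega)]
  have hdim : Module.finrank ℂ (Fin r → ℂ) = r := by simp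
  have hnt : Nontrivial (Fin r → ℂ) := Module.nontrivial_of_finrank_pos (R := ℂ) (by omega)
  have hDc : ∀ i, i < n - 3 → ∀ x, E (n - 2) (E i x) = E i (E (n - 2) x) := fun i hi x =>
    (LinearMap.congr_fun (h.comm i (n - 2) (by omega) (by omega)) x).symm
  have hDC : ∀ x, E (n - 2) x = (C (n - 1)).mulVec x := by
    intro x; rw [hEx, show n - 2 + 1 = n - 1 by omega]
  obtain ⟨D, hD⟩ : ∃ D, D = E (n - 2) := ⟨_, rfl⟩
  rw [← hD] at hDc hDC
  obtain ⟨mu, hmu⟩ := Module.End.exists_eigenvalue D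
  obtain ⟨v0, hv0⟩ := hmu.exists_hasEigenvector
  obtain ⟨N, hN⟩ : ∃ N, N = D - mu • (1 : Module.End ℂ (Fin r → ℂ)) := ⟨_, rfl⟩
  have hNc : ∀ i, i < n - 3 → ∀ x, N (E i x) = E i (N x) := by
    intro i hi x; simp [hN, hDc i hi]
  have hND : ∀ x, N (D x) = D (N x) := by intro x; simp [hN]
  -- `N` is nonzero by irreducibility
  have hN0 : N ≠ 0 := by
    intro hz
    have hDs : D = mu • 1 := sub_eq_zero.1 (hN ▸ hz)
    have e1 : n - 3 + 1 = n - 2 := by omega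
    have hadj : E (n - 3) = E (n - 3 + 1) := by
      refine braid_comm_eq (h.unit _ (by omega)) (h.unit _ (by omega)) (h.braid _ (by omega)) ?_
      rw [e1, ← hD, hDs]; simp
    have hall := h.all_eq_of_adj (by omega) hadj
    have hp := hirr (Submodule.span ℂ {v0}) (by
      intro i hi1 hi2 x hx
      obtain ⟨j, rfl⟩ : ∃ j, i = j + 1 := ⟨i - 1, by omega⟩
      rw [← hEx, hall j (n - 2) (by omega) (by omega), ← hD, hDs]
      exact Submodule.smul_mem _ _ hx)
    rcases hp with hp | hp
    · exact hv0.2 (Submodule.span_singleton_eq_bot.1 hp)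
    · have := finrank_span_singleton (K := ℂ) hv0.2
      rw [hp, finrank_top, hdim] at this
      omega
  -- a small nonzero invariant subspace
  obtain ⟨U, hU0, hUd, hUE, hUD⟩ : ∃ U : Submodule ℂ (Fin r → ℂ), U ≠ ⊥ ∧
      Module.finrank ℂ U ≤ n - 5 ∧ (∀ i, i < n - 3 → ∀ x ∈ U, E i x ∈ U) ∧
      (∀ x ∈ U, D x ∈ U) := by
    have hrk := N.finrank_range_add_finrank_ker
    rw [hdim] at hrk
    by_cases hle : Module.finrank ℂ (LinearMap.range N) ≤ n - 5
    · refine ⟨LinearMap.range N, by rwa [Ne, LinearMap.range_eq_bot], hle, ?_, ?_⟩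
      · rintro i hi _ ⟨y, rfl⟩; exact ⟨E i y, hNc i hi y⟩
      · rintro _ ⟨y, rfl⟩; exact ⟨D y, hND y⟩
    · refine ⟨LinearMap.ker N, ?_, by omega, ?_, ?_⟩
      · intro hb
        have : v0 ∈ LinearMap.ker N := by simp [hN, hv0.apply_eq_smul]
        rw [hb] at this
        exact hv0.2 (by simpa using this)
      · intro i hi x hx
        rw [LinearMap.mem_ker] at hx ⊢
        rw [hNc i hi, hx, map_zero]
      · intro x hx
        rw [LinearMap.mem_ker] at hx ⊢
        rw [hND, hx, map_zero]
  have hntU : Nontrivial U := (Submodule.nontrivial_iff_ne_bot).2 hU0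
  obtain ⟨nu, hnu⟩ := Module.End.exists_eigenvalue (resEnd U D)
  obtain ⟨u, hu⟩ := hnu.exists_hasEigenvector
  have hDu : D (u : Fin r → ℂ) = nu • (u : Fin r → ℂ) := by
    have := congrArg (fun y : U => (y : Fin r → ℂ)) hu.apply_eq_smul
    simpa only [resEnd_coe U _ hUD, Submodule.coe_smul] using this
  obtain ⟨W, hW⟩ : ∃ W, W = U ⊓ LinearMap.ker (D - nu • (1 : Module.End ℂ (Fin r → ℂ))) :=
    ⟨_, rfl⟩
  have hWm : ∀ x, x ∈ W ↔ x ∈ U ∧ D x = nu • x := by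
    intro x; simp [hW, sub_eq_zero]
  have hWE : ∀ i, i < n - 3 → ∀ x ∈ W, E i x ∈ W := by
    intro i hi x hx
    rw [hWm] at hx ⊢
    exact ⟨hUE i hi x hx.1, by rw [hDc i hi, hx.2, map_smul]⟩
  have huW : (u : Fin r → ℂ) ∈ W := (hWm _).2 ⟨u.2, hDu⟩
  have hW0 : W ≠ ⊥ := by
    intro hb
    rw [hb] at huW
    exact hu.2 (by simpa using huW)
  have hWd : Module.finrank ℂ W ≤ n - 5 :=
    (Submodule.finrank_mono (hW ▸ inf_le_left)).trans hUd
  have heq := (smallTriv (n - 3)).on_sub (h.mono (by omega)) W hWE (by omega)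
  have hntW : Nontrivial W := (Submodule.nontrivial_iff_ne_bot).2 hW0
  obtain ⟨la, hla⟩ := Module.End.exists_eigenvalue (resEnd W (E 0))
  obtain ⟨v, hv⟩ := hla.exists_hasEigenvector
  have hEv : E 0 (v : Fin r → ℂ) = la • (v : Fin r → ℂ) := by
    have := congrArg (fun y : W => (y : Fin r → ℂ)) hv.apply_eq_smul
    simpa only [resEnd_coe W _ (hWE 0 (by omega)), Submodule.coe_smul] using this
  refine ⟨v, fun hz => hv.2 (Subtype.ext hz), ?_⟩
  rintro i (⟨hi1, hi2⟩ | rfl)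
  · obtain ⟨j, rfl⟩ : ∃ j, i = j + 1 := ⟨i - 1, by omega⟩
    rw [← hEx, heq j 0 (by omega) (by omega) v v.2, hEv]
    exact Submodule.smul_mem _ _ (Submodule.mem_span_singleton_self _)
  · rw [← hDC, ((hWm _).1 v.2).2]
    exact Submodule.smul_mem _ _ (Submodule.mem_span_singleton_self _)
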